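/- Let n ≥ 2. Then in ℤ[q], 𝔣_{n-1}(q) ≡ Σ_{1≤r≤n, gcd(r,n)=1} q^r modulo the n-th cyclotomic polynomial Φ_n(q). -/

import Mathlib

open Finset Polynomial

/-- The representative in `{1,…,n}` of a residue class `a : ZMod n`. -/
def zrep (n : ℕ) (a : ZMod n) : ℕ := if a.val = 0 then n else a.val

/-- The major index of a permutation of `{1,…,n}` (identified with `ZMod n`). -/
def maj (n : ℕ) (σ : Equiv.Perm (ZMod n)) : ℕ :=
  ∑ i ∈ Finset.Icc 1 (n - 1),
    if zrep n (σ ((i : ZMod n) + 1)) < zrep n (σ (i : ZMod n)) then i else 0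

/-- The cyclic major index. -/
def majbar (n : ℕ) (σ : Equiv.Perm (ZMod n)) : ℕ :=
  ∑ i ∈ Finset.Icc 1 n,
    if zrep n (σ ((i : ZMod n) + 1)) < zrep n (σ (i : ZMod n)) then i else 0

/-- The cyclic descent number. -/
def desbar (n : ℕ) (σ : Equiv.Perm (ZMod n)) : ℕ :=
  ((Finset.Icc 1 n).filter
    (fun i : ℕ => zrep n (σ (((i : ℕ) : ZMod n) + 1)) < zrep n (σ ((i : ℕ) : ZMod n)))).card

/-- Conjugation by the rotation `a ↦ a + 1`. -/
def Tmap (n : ℕ) (σ : Equiv.Perm (ZMod n)) : Equiv.Perm (ZMod n) :=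
  Equiv.addRight (1 : ZMod n) * σ * (Equiv.addRight (1 : ZMod n))⁻¹
/-- The set of cyclic descents of `σ`, as residue classes. -/
def cyclicDescents (n : ℕ) [NeZero n] (σ : Equiv.Perm (ZMod n)) : Finset (ZMod n) :=
  univ.filter fun i => zrep n (σ (i + 1)) < zrep n (σ i)

section

variable {n : ℕ}

lemma zrep_eq_val_of_ne_zero {a : ZMod n} (ha : a ≠ 0) : zrep n a = a.val := by
  rw [zrep, if_neg]; rwa [ZMod.val_eq_zero]

lemma zrep_zero : zrep n (0 : ZMod n) = n := by
  simp [zrep]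

lemma Tmap_apply_add_one (σ : Equiv.Perm (ZMod n)) (i : ZMod n) :
    Tmap n σ (i + 1) = σ i + 1 := by
  simp [Tmap, Equiv.Perm.mul_apply]

lemma one_le_val_sub (hn : 2 ≤ n) (σ : Equiv.Perm (ZMod n)) (i : ZMod n) :
    1 ≤ (σ (i + 1) - σ i).val := by
  have : Fact (1 < n) := ⟨hn⟩
  rw [Nat.one_le_iff_ne_zero, ne_eq, ZMod.val_eq_zero, sub_eq_zero]
  simp

lemma pow_eq_pow_of_natCast_eq {R : Type*} [Monoid R] {ζ : R} (hζ : ζ ^ n = 1) {a b : ℕ}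
    (h : (a : ZMod n) = b) : ζ ^ a = ζ ^ b := by
  rw [pow_eq_pow_mod a hζ, pow_eq_pow_mod b hζ, (ZMod.natCast_eq_natCast_iff' a b n).1 h]

lemma addRight_zpow_apply_zero (c : ZMod n) (k : ℤ) : (Equiv.addRight c ^ k) 0 = k * c := by
  have h : (Equiv.addRight c ^ k : Equiv.Perm (ZMod n)) = Equiv.addRight (k • c) := by simp
  simp [h]

variable [NeZero n]

lemma sum_add_one {M : Type*} [AddCommMonoid M] (f : ZMod n → M) :
    ∑ i, f (i + 1) = ∑ i, f i :=
  Equiv.sum_comp (Equiv.addRight (1 : ZMod n)) f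

lemma zrep_add_one (a : ZMod n) : zrep n (a + 1) = a.val + 1 := by
  have h := ZMod.val_lt a
  rcases Nat.lt_or_ge (a.val + 1) n with h1 | h1
  · have h2 : (a + 1).val = a.val + 1 := by
      rw [← ZMod.val_natCast_of_lt h1, Nat.cast_succ, ZMod.natCast_zmod_val]
    rw [zrep, h2, if_neg (Nat.succ_ne_zero _)]
  · have h2 : a + 1 = 0 := by
      have h3 : a.val + 1 = n := by omega
      have h4 := congrArg (Nat.cast : ℕ → ZMod n) h3
      rwa [Nat.cast_succ, ZMod.natCast_zmod_val, ZMod.natCast_self] at h4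
    rw [zrep, h2, ZMod.val_zero, if_pos rfl]
    omega

lemma zrep_eq (a : ZMod n) : zrep n a = (a - 1).val + 1 := by
  rw [← zrep_add_one, sub_add_cancel]

lemma zrep_pos (a : ZMod n) : 0 < zrep n a := by
  rw [zrep_eq]; omega

lemma zrep_le (a : ZMod n) : zrep n a ≤ n := by
  rw [zrep_eq]; exact ZMod.val_lt _

lemma natCast_zrep (a : ZMod n) : (zrep n a : ZMod n) = a := by
  rw [zrep_eq]; simp

lemma mem_cyclicDescents {σ : Equiv.Perm (ZMod n)} {i : ZMod n} :
    i ∈ cyclicDescents n σ ↔ zrep n (σ (i + 1)) < zrep n (σ i) := by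
  simp [cyclicDescents]

lemma natCast_maj (σ : Equiv.Perm (ZMod n)) :
    (maj n σ : ZMod n) = ∑ i ∈ cyclicDescents n σ, i := by
  have h1 : (maj n σ : ZMod n) = ∑ i ∈ Finset.range n,
      if zrep n (σ ((i : ZMod n) + 1)) < zrep n (σ (i : ZMod n)) then (i : ZMod n) else 0 := by
    rw [maj, Nat.cast_sum]
    simp only [Nat.cast_ite, Nat.cast_zero]
    refine Finset.sum_subset (fun i hi => ?_) (fun i hi hi' => ?_)
    · simp only [Finset.mem_Icc, Finset.mem_range] at *; omega
    · have : i = 0 := by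
        simp only [Finset.mem_Icc, Finset.mem_range] at *; omega
      simp [this]
  rw [h1, cyclicDescents, Finset.sum_filter]
  refine Finset.sum_nbij' (fun i => (i : ZMod n)) ZMod.val (by simp) ?_ ?_ (by simp) (by simp)
  · intro a _; simpa using ZMod.val_lt a
  · intro a ha; exact ZMod.val_natCast_of_lt (Finset.mem_range.1 ha)

/-- Conjugation by the rotation shifts the cyclic descents by one, except that the descent
following the largest value moves to the position preceding it. -/
lemma indicator_cyclicDescents_Tmap (hn : 2 ≤ n) (σ : Equiv.Perm (ZMod n)) (i : ZMod n) :
    ((if i + 1 ∈ cyclicDescents n (Tmap n σ) then 1 else 0) + (if i = σ.symm 0 then 1 else 0) : ℕ)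
      = (if i ∈ cyclicDescents n σ then 1 else 0) + (if i + 1 = σ.symm 0 then 1 else 0) := by
  have : Fact (1 < n) := ⟨hn⟩
  have hne : σ (i + 1) ≠ σ i := by simp
  simp only [mem_cyclicDescents, Tmap_apply_add_one, zrep_add_one, Equiv.eq_symm_apply]
  generalize σ (i + 1) = b at *
  generalize σ i = a at *
  have ha := ZMod.val_lt a
  have hb := ZMod.val_lt b
  by_cases ha0 : a = 0
  · have hb0 : b ≠ 0 := fun h => hne (h.trans ha0.symm)
    simp [ha0, hb0, zrep_zero, zrep_eq_val_of_ne_zero hb0, hb]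
  · by_cases hb0 : b = 0
    · have : 0 < a.val := by rwa [Nat.pos_iff_ne_zero, ne_eq, ZMod.val_eq_zero]
      simp [ha0, hb0, zrep_zero, zrep_eq_val_of_ne_zero ha0, ha.le, this]
    · simp [ha0, hb0, zrep_eq_val_of_ne_zero ha0, zrep_eq_val_of_ne_zero hb0]

lemma card_cyclicDescents_Tmap (hn : 2 ≤ n) (σ : Equiv.Perm (ZMod n)) :
    (cyclicDescents n (Tmap n σ)).card = (cyclicDescents n σ).card := by
  have h := Finset.sum_congr (rfl : (univ : Finset (ZMod n)) = univ)
    fun i _ => indicator_cyclicDescents_Tmap hn σ i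
  rw [Finset.sum_add_distrib, Finset.sum_add_distrib,
    sum_add_one (fun i => if i ∈ cyclicDescents n (Tmap n σ) then 1 else 0),
    sum_add_one (fun i => if i = σ.symm 0 then 1 else 0)] at h
  simpa using h

lemma sum_cyclicDescents_Tmap (hn : 2 ≤ n) (σ : Equiv.Perm (ZMod n)) :
    ∑ i ∈ cyclicDescents n (Tmap n σ), i + 1 =
      ∑ i ∈ cyclicDescents n σ, i + ((cyclicDescents n σ).card : ZMod n) := by
  have h := Finset.sum_congr (rfl : (univ : Finset (ZMod n)) = univ) fun i _ =>
    congrArg (fun k : ℕ => (k : ZMod n) * (i + 1)) (indicator_cyclicDescents_Tmap hn σ i)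
  simp only [Nat.cast_add, Nat.cast_ite, Nat.cast_one, Nat.cast_zero, add_mul (R := ZMod n),
    ite_mul, one_mul, zero_mul] at h
  rw [Finset.sum_add_distrib, Finset.sum_add_distrib,
    sum_add_one (fun i => if i ∈ cyclicDescents n (Tmap n σ) then i else 0),
    sum_add_one (fun i => if i = σ.symm 0 then i else 0)] at h
  simp only [Finset.sum_ite_mem, Finset.univ_inter, Finset.sum_ite_eq', Finset.mem_univ, if_true,
    Finset.sum_add_distrib, Finset.sum_const, nsmul_eq_mul, mul_one] at h
  linear_combination h

lemma val_sub_eq (a b : ZMod n) (hab : a ≠ b) :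
    (((b - a).val : ℕ) : ℤ) =
      (zrep n b : ℤ) - zrep n a + n * (if zrep n b < zrep n a then 1 else 0) := by
  have h1 := zrep_pos a
  have h2 := zrep_le a
  have h3 := zrep_pos b
  have h4 := zrep_le b
  have hne : zrep n a ≠ zrep n b := fun h => hab <| by
    rw [← natCast_zrep a, h, natCast_zrep b]
  split_ifs with h
  · have : b - a = ((zrep n b + n - zrep n a : ℕ) : ZMod n) := by
      rw [Nat.cast_sub (by omega)]; simp [natCast_zrep]
    rw [this, ZMod.val_natCast_of_lt (by omega)]
    omega
  · have : b - a = ((zrep n b - zrep n a : ℕ) : ZMod n) := by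
      rw [Nat.cast_sub (by omega)]; simp [natCast_zrep]
    rw [this, ZMod.val_natCast_of_lt (by omega)]
    omega

lemma sum_val_sub (hn : 2 ≤ n) (σ : Equiv.Perm (ZMod n)) :
    ∑ i, (σ (i + 1) - σ i).val = n * (cyclicDescents n σ).card := by
  have : Fact (1 < n) := ⟨hn⟩
  zify
  rw [Finset.sum_congr rfl fun i _ => val_sub_eq (σ i) (σ (i + 1)) (by simp),
    Finset.sum_add_distrib, Finset.sum_sub_distrib,
    sum_add_one (fun i => (zrep n (σ i) : ℤ)), sub_self, zero_add,
    ← Finset.mul_sum, cyclicDescents, Finset.card_filter]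
  push_cast
  rfl

lemma card_cyclicDescents_pos (hn : 2 ≤ n) (σ : Equiv.Perm (ZMod n)) :
    0 < (cyclicDescents n σ).card := by
  have h : 0 < ∑ i, (σ (i + 1) - σ i).val :=
    Finset.sum_pos (fun i _ => one_le_val_sub hn σ i) Finset.univ_nonempty
  rw [sum_val_sub hn] at h
  exact Nat.pos_of_mul_pos_left h

lemma card_cyclicDescents_lt (hn : 2 ≤ n) (σ : Equiv.Perm (ZMod n)) :
    (cyclicDescents n σ).card < n := by
  have h : ∑ i, (σ (i + 1) - σ i).val < ∑ _i : ZMod n, n :=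
    Finset.sum_lt_sum_of_nonempty Finset.univ_nonempty fun i _ => ZMod.val_lt _
  rw [sum_val_sub hn] at h
  simp only [Finset.sum_const, Finset.card_univ, ZMod.card, smul_eq_mul] at h
  exact Nat.lt_of_mul_lt_mul_left h

lemma eq_addRight_of_card_cyclicDescents_eq_one (hn : 2 ≤ n) {σ : Equiv.Perm (ZMod n)}
    (h : (cyclicDescents n σ).card = 1) : σ = Equiv.addRight (σ 0) := by
  have hsum : ∑ _i : ZMod n, 1 = ∑ i, (σ (i + 1) - σ i).val := by
    simp [sum_val_sub hn, h]
  have hstep (i : ZMod n) : σ (i + 1) = σ i + 1 := by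
    have := (Finset.sum_eq_sum_iff_of_le fun i _ => one_le_val_sub hn σ i).1 hsum i
      (Finset.mem_univ i)
    rw [← sub_eq_iff_eq_add', ← ZMod.natCast_zmod_val (σ (i + 1) - σ i), ← this, Nat.cast_one]
  have hnat (k : ℕ) : σ k = k + σ 0 := by
    induction k with
    | zero => simp
    | succ k ih => rw [Nat.cast_succ, hstep, ih]; ring
  ext1 i
  rw [← ZMod.natCast_zmod_val i, hnat, Equiv.coe_addRight]

lemma cyclicDescents_addRight (hn : 2 ≤ n) (c : ZMod n) :
    cyclicDescents n (Equiv.addRight c) = {-c} := by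
  have : Fact (1 < n) := ⟨hn⟩
  ext i
  rw [mem_cyclicDescents, Finset.mem_singleton, Equiv.coe_addRight]
  beta_reduce
  rw [add_right_comm, zrep_add_one, eq_neg_iff_add_eq_zero]
  generalize i + c = a
  by_cases ha : a = 0
  · simpa [ha, zrep_zero] using this.out
  · simp [ha, zrep_eq_val_of_ne_zero ha]

lemma isCycle_addRight_iff (hn : 2 ≤ n) (c : ZMod n) :
    (Equiv.addRight c : Equiv.Perm (ZMod n)).IsCycle ∧
      (Equiv.addRight c : Equiv.Perm (ZMod n)).support.card = n ↔ IsUnit c := by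
  have : Fact (1 < n) := ⟨hn⟩
  constructor
  · rintro ⟨hc, hcard⟩
    have hsupp := (Finset.card_eq_iff_eq_univ _).1 (hcard.trans (ZMod.card n).symm)
    have hmem (x : ZMod n) : (Equiv.addRight c : Equiv.Perm (ZMod n)) x ≠ x := by
      rw [← Equiv.Perm.mem_support, hsupp]; exact Finset.mem_univ x
    obtain ⟨k, hk⟩ := hc.sameCycle (hmem 0) (hmem 1)
    rw [addRight_zpow_apply_zero] at hk
    exact IsUnit.of_mul_eq_one_right _ hk
  · intro hc
    have hc0 : c ≠ 0 := hc.ne_zero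
    refine ⟨⟨0, by simpa using hc0, fun y _ => ?_⟩, ?_⟩
    · obtain ⟨u, rfl⟩ := hc
      refine ⟨((y * (u⁻¹ : (ZMod n)ˣ)).val : ℤ), ?_⟩
      rw [addRight_zpow_apply_zero]
      simp
    · have : (Equiv.addRight c : Equiv.Perm (ZMod n)).support = univ := by
        ext x; simpa using hc0
      rw [this, Finset.card_univ, ZMod.card]

lemma pow_maj_Tmap {R : Type*} [Monoid R] {ζ : R} (hζ : ζ ^ n = 1) (hn : 2 ≤ n)
    (σ : Equiv.Perm (ZMod n)) :
    ζ ^ maj n (Tmap n σ) = ζ ^ maj n σ * ζ ^ ((cyclicDescents n σ).card - 1) := by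
  rw [← pow_add]
  apply pow_eq_pow_of_natCast_eq hζ
  rw [Nat.cast_add, natCast_maj, natCast_maj, Nat.cast_sub (card_cyclicDescents_pos hn σ),
    Nat.cast_one]
  linear_combination sum_cyclicDescents_Tmap hn σ

/-- Over a set stable under conjugation by the rotation, only permutations with a single cyclic
descent contribute to the sum of `ζ ^ maj`. -/
lemma sum_pow_maj_eq_zero {K : Type*} [Field K] {ζ : K} (hζ : IsPrimitiveRoot ζ n) (hn : 2 ≤ n)
    (S : Finset (Equiv.Perm (ZMod n))) (hS : ∀ σ, Tmap n σ ∈ S ↔ σ ∈ S)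
    (hd : ∀ σ ∈ S, (cyclicDescents n σ).card ≠ 1) :
    ∑ σ ∈ S, ζ ^ maj n σ = 0 := by
  set w : Equiv.Perm (ZMod n) → K :=
    fun σ => ζ ^ maj n σ / (ζ ^ ((cyclicDescents n σ).card - 1) - 1) with hw
  have hterm : ∀ σ ∈ S, ζ ^ maj n σ = w (Tmap n σ) - w σ := by
    intro σ hσ
    have hpos := card_cyclicDescents_pos hn σ
    have hlt := card_cyclicDescents_lt hn σ
    have hne := hd σ hσ
    have h0 : ζ ^ ((cyclicDescents n σ).card - 1) - 1 ≠ 0 :=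
      sub_ne_zero.2 (hζ.pow_ne_one_of_pos_of_lt (by omega) (by omega))
    simp only [hw, card_cyclicDescents_Tmap hn, pow_maj_Tmap hζ.pow_eq_one hn]
    field_simp
  rw [Finset.sum_congr rfl hterm, Finset.sum_sub_distrib, sub_eq_zero]
  exact Finset.sum_equiv (MulAut.conj (Equiv.addRight (1 : ZMod n))).toEquiv
    (fun σ => (hS σ).symm) (fun σ _ => rfl)

end

lemma isCycle_conj_iff {α : Type*} {σ τ : Equiv.Perm α} :
    (τ * σ * τ⁻¹).IsCycle ↔ σ.IsCycle :=
  ⟨fun h => by simpa [mul_assoc] using h.conj (g := τ⁻¹), fun h => h.conj⟩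

open scoped Classical in
lemma sum_pow_maj_isCycle {K : Type*} [Field K] {n : ℕ} [NeZero n] {ζ : K}
    (hζ : IsPrimitiveRoot ζ n) (hn : 2 ≤ n) :
    ∑ σ ∈ Finset.univ.filter
        (fun σ : Equiv.Perm (ZMod n) => σ.IsCycle ∧ σ.support.card = n), ζ ^ maj n σ =
      ∑ r ∈ (Finset.Icc 1 n).filter (fun r => Nat.gcd r n = 1), ζ ^ r := by
  have hlt {r : ℕ} (hr : r ∈ (Finset.Icc 1 n).filter (fun r => Nat.gcd r n = 1)) : r < n := by
    rw [Finset.mem_filter, Finset.mem_Icc] at hr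
    refine lt_of_le_of_ne hr.1.2 fun h => ?_
    have := hr.2
    rw [h, Nat.gcd_self] at this
    omega
  rw [← Finset.sum_filter_add_sum_filter_not _ (fun σ => (cyclicDescents n σ).card = 1),
    sum_pow_maj_eq_zero hζ hn (Finset.filter (fun σ => ¬ (cyclicDescents n σ).card = 1) _)
      (fun σ => ?_) (fun σ hσ => (Finset.mem_filter.1 hσ).2), add_zero]
  · symm
    refine Finset.sum_nbij (fun r => Equiv.addRight (-(r : ZMod n))) ?_ ?_ ?_ ?_
    · intro r hr
      rw [Finset.mem_filter, Finset.mem_filter, isCycle_addRight_iff hn,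
        cyclicDescents_addRight hn]
      exact ⟨⟨Finset.mem_univ _, ((ZMod.isUnit_iff_coprime r n).2 (Finset.mem_filter.1 hr).2).neg⟩,
        Finset.card_singleton _⟩
    · intro r hr s hs hrs
      have h := congrArg (fun σ : Equiv.Perm (ZMod n) => σ 0) hrs
      simp only [Equiv.coe_addRight, zero_add, neg_inj] at h
      rw [← ZMod.val_natCast_of_lt (hlt hr), h, ZMod.val_natCast_of_lt (hlt hs)]
    · intro σ hσ
      rw [Finset.mem_coe, Finset.mem_filter, Finset.mem_filter] at hσ
      have hσ' := eq_addRight_of_card_cyclicDescents_eq_one hn hσ.2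
      have hu : IsUnit (σ 0) := by
        rw [← isCycle_addRight_iff hn, ← hσ']
        exact hσ.1.2
      have : Fact (1 < n) := ⟨hn⟩
      refine ⟨(-σ 0).val, ?_, ?_⟩
      · rw [Finset.mem_coe, Finset.mem_filter, Finset.mem_Icc, Nat.one_le_iff_ne_zero, ne_eq,
          ZMod.val_eq_zero]
        refine ⟨⟨hu.neg.ne_zero, (ZMod.val_lt _).le⟩, (ZMod.isUnit_iff_coprime _ n).1 ?_⟩
        rw [ZMod.natCast_zmod_val]
        exact hu.neg
      · simp only [ZMod.natCast_zmod_val, neg_neg]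
        exact hσ'.symm
    · intro r _
      apply pow_eq_pow_of_natCast_eq hζ.pow_eq_one
      rw [natCast_maj, cyclicDescents_addRight hn, Finset.sum_singleton, neg_neg]
  · simp only [Finset.mem_filter, Finset.mem_univ, true_and, card_cyclicDescents_Tmap hn]
    simp only [Tmap, Equiv.Perm.card_support_conj, isCycle_conj_iff]

open scoped Classical in
/-- `𝔣_{n-1}(q) ≡ Σ_{1≤r≤n, (r,n)=1} q^r (mod Φ_n(q))` in ℤ[q]. -/
theorem f_cong_coprime_sum (n : ℕ) [NeZero n] (hn : 2 ≤ n) :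
    Polynomial.cyclotomic n ℤ ∣
      (∑ σ ∈ Finset.univ.filter
          (fun σ : Equiv.Perm (ZMod n) => σ.IsCycle ∧ σ.support.card = n),
        (Polynomial.X : Polynomial ℤ) ^ maj n σ) -
      ∑ r ∈ (Finset.Icc 1 n).filter (fun r => Nat.gcd r n = 1),
        (Polynomial.X : Polynomial ℤ) ^ r := by
  have hζ := Complex.isPrimitiveRoot_exp n (NeZero.ne n)
  rw [Polynomial.cyclotomic_eq_minpoly hζ (NeZero.pos n)]
  apply minpoly.isIntegrallyClosed_dvd (hζ.isIntegral (NeZero.pos n))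
  simp only [map_sub, map_sum, map_pow, Polynomial.aeval_X]
  rw [sub_eq_zero]
  exact sum_pow_maj_isCycle hζ hn
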